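/- Consider the adjacent-categories npo model with common predictor vectors, with parameter space Θ = (ℝ^q)^{J−1} (all parameter tuples). Let Y : Fin m → Fin J → ℝ be nonnegative counts. Then all orders of the response categories are equivalent: for any two permutations σ₁, σ₂ of {1,…,J}, ⨆_{θ∈Θ} l_{σ₁}(θ) = ⨆_{θ∈Θ} l_{σ₂}(θ). -/

import Mathlib

/-- Linear predictor of the adjacent-categories npo model with common predictor vectors. -/
noncomputable def anpoEta (m K q : ℕ) (a : Fin m → Fin q → ℝ)
    (β : Fin K → Fin q → ℝ) (i : Fin m) (j : Fin K) : ℝ :=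
  ∑ x, a i x * β j x

/-- Category probabilities of the adjacent-categories npo model (`J = K + 1` categories). -/
noncomputable def anpoPi (m K q : ℕ) (a : Fin m → Fin q → ℝ)
    (β : Fin K → Fin q → ℝ) (i : Fin m) (c : Fin (K + 1)) : ℝ :=
  (if (c : ℕ) < K then
      Real.exp (∑ l ∈ Finset.univ.filter (fun l : Fin K => (c : ℕ) ≤ (l : ℕ)),
        anpoEta m K q a β i l)
    else 1) /
    (1 + ∑ s : Fin K,
      Real.exp (∑ l ∈ Finset.univ.filter (fun l : Fin K => s ≤ l), anpoEta m K q a β i l))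

theorem anpo_tail_step {K : ℕ} (f : Fin K → ℝ) (c : Fin K) :
    ∑ l ∈ Finset.univ.filter (fun l : Fin K => ((c.castSucc : Fin (K+1)) : ℕ) ≤ (l : ℕ)), f l
      = f c + ∑ l ∈ Finset.univ.filter (fun l : Fin K => ((c.succ : Fin (K+1)) : ℕ) ≤ (l : ℕ)), f l := by
  rw [← Finset.sum_insert (by simp)]
  congr 1
  ext l
  simp [Fin.ext_iff]
  omega

theorem anpo_tail {K : ℕ} (f : Fin K → ℝ) (e : Fin (K+1) → ℝ)
    (h : ∀ l : Fin K, f l = e l.castSucc - e l.succ) (c : Fin (K+1)) :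
    ∑ l ∈ Finset.univ.filter (fun l : Fin K => (c : ℕ) ≤ (l : ℕ)), f l = e c - e (Fin.last K) := by
  induction c using Fin.reverseInduction with
  | last =>
    rw [Finset.sum_eq_zero, sub_self]
    intro l hl
    have := l.2
    simp at hl
    omega
  | cast c ih => rw [anpo_tail_step, ih, h]; ring

theorem anpo_softmax (m K q : ℕ) (a : Fin m → Fin q → ℝ)
    (β : Fin K → Fin q → ℝ) (i : Fin m) (e : Fin (K+1) → ℝ)
    (h : ∀ l : Fin K, anpoEta m K q a β i l = e l.castSucc - e l.succ) (c : Fin (K+1)) :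
    anpoPi m K q a β i c = Real.exp (e c) / ∑ s, Real.exp (e s) := by
  have hnum : (if (c : ℕ) < K then
      Real.exp (∑ l ∈ Finset.univ.filter (fun l : Fin K => (c : ℕ) ≤ (l : ℕ)),
        anpoEta m K q a β i l)
    else 1) = Real.exp (e c) / Real.exp (e (Fin.last K)) := by
    split_ifs with hc
    · rw [anpo_tail _ e h, Real.exp_sub]
    · have : c = Fin.last K := by
        have := c.2
        ext
        simp
        omega
      subst this
      rw [div_self (Real.exp_pos _).ne']
  have hs : ∀ s : Fin K, Real.exp (∑ l ∈ Finset.univ.filter (fun l : Fin K => s ≤ l),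
      anpoEta m K q a β i l) = Real.exp (e s.castSucc) / Real.exp (e (Fin.last K)) := by
    intro s
    rw [← Real.exp_sub, ← anpo_tail _ e h s.castSucc]
    rfl
  have hp := (Real.exp_pos (e (Fin.last K))).ne'
  unfold anpoPi
  rw [hnum, Finset.sum_congr rfl (fun s _ => hs s), ← Finset.sum_div, Fin.sum_univ_castSucc]
  rw [← div_self hp, ← add_div, div_div_div_cancel_right₀ hp, add_comm]

theorem anpo_perm (m K q : ℕ) (a : Fin m → Fin q → ℝ)
    (β : Fin K → Fin q → ℝ) (τ : Equiv.Perm (Fin (K+1))) :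
    ∃ β' : Fin K → Fin q → ℝ, ∀ i c, anpoPi m K q a β' i c = anpoPi m K q a β i (τ c) := by
  let G : Fin (K+1) → Fin q → ℝ := fun c x =>
    ∑ l ∈ Finset.univ.filter (fun l : Fin K => (c : ℕ) ≤ (l : ℕ)), β l x
  let e : Fin m → Fin (K+1) → ℝ := fun i c => ∑ x, a i x * G c x
  refine ⟨fun l x => G (τ l.castSucc) x - G (τ l.succ) x, fun i c => ?_⟩
  rw [anpo_softmax m K q a _ i (fun c => e i (τ c)), anpo_softmax m K q a β i (e i)]
  · rw [Equiv.sum_comp τ (fun s => Real.exp (e i s))]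
  · intro l
    simp only [anpoEta, e, ← Finset.sum_sub_distrib, ← mul_sub]
    refine Finset.sum_congr rfl fun x _ => ?_
    simp only [G]
    rw [anpo_tail_step (fun l => β l x)]
    ring
  · intro l
    simp only [anpoEta, e, ← Finset.sum_sub_distrib, ← mul_sub]

theorem anpo_range (m K q : ℕ) (a : Fin m → Fin q → ℝ) (Y : Fin m → Fin (K + 1) → ℝ)
    (σ₁ σ₂ : Equiv.Perm (Fin (K + 1))) (β : Fin K → Fin q → ℝ) :
    ∃ β' : Fin K → Fin q → ℝ,
      ∑ i, ∑ j, Y i (σ₂ j) * Real.log (anpoPi m K q a β' i j) =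
        ∑ i, ∑ j, Y i (σ₁ j) * Real.log (anpoPi m K q a β i j) := by
  obtain ⟨β', h⟩ := anpo_perm m K q a β (σ₂.trans σ₁.symm)
  refine ⟨β', Finset.sum_congr rfl fun i _ => ?_⟩
  rw [← Equiv.sum_comp (σ₂.trans σ₁.symm)
    (fun j => Y i (σ₁ j) * Real.log (anpoPi m K q a β i j))]
  refine Finset.sum_congr rfl fun j _ => ?_
  rw [h]
  simp

/-- In the adjacent-categories npo model with common predictor vectors and full
parameter space, all orders of the response categories are equivalent: any two permutations
attain the same supremum of the reduced log-likelihood. -/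
theorem adjacent_npo_all_orders_equivalent
    (m K q : ℕ) (hm : 1 ≤ m) (hK : 2 ≤ K)
    (a : Fin m → Fin q → ℝ)
    (Y : Fin m → Fin (K + 1) → ℝ) (hY : ∀ i j, 0 ≤ Y i j)
    (σ₁ σ₂ : Equiv.Perm (Fin (K + 1))) :
    (⨆ β : Fin K → Fin q → ℝ,
        ∑ i, ∑ j, Y i (σ₁ j) * Real.log (anpoPi m K q a β i j)) =
    (⨆ β : Fin K → Fin q → ℝ,
        ∑ i, ∑ j, Y i (σ₂ j) * Real.log (anpoPi m K q a β i j)) := by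
  show sSup _ = sSup _
  congr 1
  ext y
  constructor
  · rintro ⟨β, rfl⟩
    exact anpo_range m K q a Y σ₁ σ₂ β
  · rintro ⟨β, rfl⟩
    exact anpo_range m K q a Y σ₂ σ₁ β
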